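/- arXiv:2308.05471 — 7 statements merged into one kernel-verified Lean document; each statement's English description precedes it below -/
import Mathlib

section
/- Let A be a finite set, let η > 0, and let Q : A → [0,1]. Let p be a probability distribution on A with p(a) > 0 for all a ∈ A, and let p⋆ be any probability distribution on A. Define the distribution p′ on A by p′(a) = p(a)·exp(η·Q(a)) / Σ_{a′∈A} p(a′)·exp(η·Q(a′)). Then Σ_{a∈A} Q(a)·(p⋆(a) − p(a)) ≤ η/2 + (1/η)·( D_KL(p⋆ ‖ p) − D_KL(p⋆ ‖ p′) ). -/
/-- A weak form of Hoeffding's lemma for a distribution on a finite set. -/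
theorem sum_mul_exp_le_exp_add_sq {A : Type*} [Fintype A] (η : ℝ) {Q p : A → ℝ}
    (hQ : ∀ a, 0 ≤ Q a ∧ Q a ≤ 1) (hp : ∀ a, 0 ≤ p a) (hp_sum : ∑ a, p a = 1) :
    ∑ a, p a * Real.exp (η * Q a) ≤ Real.exp (η * ∑ a, p a * Q a + η ^ 2 / 2) := by
  set m := ∑ a, p a * Q a with hm
  have hm0 : 0 ≤ m := Finset.sum_nonneg fun a _ => mul_nonneg (hp a) (hQ a).1
  have hm1 : m ≤ 1 := by
    rw [← hp_sum]
    exact Finset.sum_le_sum fun a _ => mul_le_of_le_one_right (hp a) (hQ a).2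
  have hcentered : ∑ a, p a * (Real.cosh η + (Q a - m) * Real.sinh η) = Real.cosh η := by
    have h : ∀ a, p a * (Real.cosh η + (Q a - m) * Real.sinh η) =
        p a * (Real.cosh η - m * Real.sinh η) + p a * Q a * Real.sinh η := fun a => by ring
    simp_rw [h]
    rw [Finset.sum_add_distrib, ← Finset.sum_mul, ← Finset.sum_mul, hp_sum, ← hm]
    ring
  calc ∑ a, p a * Real.exp (η * Q a)
      = Real.exp (η * m) * ∑ a, p a * Real.exp ((Q a - m) * η) := by
        rw [Finset.mul_sum]
        refine Finset.sum_congr rfl fun a _ => ?_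
        rw [mul_left_comm, ← Real.exp_add]
        ring_nf
    _ ≤ Real.exp (η * m) * ∑ a, p a * (Real.cosh η + (Q a - m) * Real.sinh η) := by
        gcongr with a
        · exact hp a
        · refine Real.exp_mul_le_cosh_add_mul_sinh (abs_le.2 ⟨?_, ?_⟩) η <;>
            linarith [hQ a]
    _ ≤ Real.exp (η * m) * Real.exp (η ^ 2 / 2) := by
        rw [hcentered]
        gcongr
        exact Real.cosh_le_exp_half_sq η
    _ = Real.exp (η * m + η ^ 2 / 2) := (Real.exp_add _ _).symm

/-- One-step mirror-descent (online mirror descent with KL regularizer) inequality. -/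
theorem stmt_0 {A : Type*} [Fintype A] [Nonempty A]
    (η : ℝ) (hη : 0 < η)
    (Q : A → ℝ) (hQ : ∀ a, 0 ≤ Q a ∧ Q a ≤ 1)
    (p pstar p' : A → ℝ)
    (hp_pos : ∀ a, 0 < p a) (hp_sum : ∑ a, p a = 1)
    (hps_nonneg : ∀ a, 0 ≤ pstar a) (hps_sum : ∑ a, pstar a = 1)
    (hp' : ∀ a, p' a = p a * Real.exp (η * Q a) / ∑ a', p a' * Real.exp (η * Q a')) :
    ∑ a, Q a * (pstar a - p a) ≤
      η / 2 + (1 / η) *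
        ((∑ a, pstar a * Real.log (pstar a / p a)) -
         (∑ a, pstar a * Real.log (pstar a / p' a))) := by
  set Z := ∑ a, p a * Real.exp (η * Q a)
  have hZpos : 0 < Z :=
    Finset.sum_pos (fun a _ => mul_pos (hp_pos a) (Real.exp_pos _)) Finset.univ_nonempty
  have hlogZ : Real.log Z ≤ η * ∑ a, p a * Q a + η ^ 2 / 2 :=
    (Real.log_le_iff_le_exp hZpos).2
      (sum_mul_exp_le_exp_add_sq η hQ (fun a => (hp_pos a).le) hp_sum)
  have hterm : ∀ a, pstar a * Real.log (pstar a / p a) - pstar a * Real.log (pstar a / p' a) =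
      η * (pstar a * Q a) - pstar a * Real.log Z := by
    intro a
    rcases (hps_nonneg a).eq_or_lt with h | h
    · simp [← h]
    · have hpa := hp_pos a
      have hnum : 0 < p a * Real.exp (η * Q a) := mul_pos hpa (Real.exp_pos _)
      rw [hp' a, Real.log_div h.ne' hpa.ne', Real.log_div h.ne' (div_pos hnum hZpos).ne',
        Real.log_div hnum.ne' hZpos.ne', Real.log_mul hpa.ne' (Real.exp_ne_zero _),
        Real.log_exp]
      ring
  have hKL : (∑ a, pstar a * Real.log (pstar a / p a)) -
      (∑ a, pstar a * Real.log (pstar a / p' a)) =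
      η * ∑ a, pstar a * Q a - Real.log Z := by
    rw [← Finset.sum_sub_distrib, Finset.sum_congr rfl fun a _ => hterm a,
      Finset.sum_sub_distrib, ← Finset.mul_sum, ← Finset.sum_mul, hps_sum, one_mul]
  have hlhs : ∑ a, Q a * (pstar a - p a) = ∑ a, pstar a * Q a - ∑ a, p a * Q a := by
    rw [← Finset.sum_sub_distrib]
    exact Finset.sum_congr rfl fun a _ => by ring
  rw [hKL, hlhs, ← sub_nonneg]
  have hrewrite : η / 2 + 1 / η * (η * ∑ a, pstar a * Q a - Real.log Z) -
      (∑ a, pstar a * Q a - ∑ a, p a * Q a) =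
      (η * ∑ a, p a * Q a + η ^ 2 / 2 - Real.log Z) / η := by
    field_simp
    ring
  rw [hrewrite]
  exact div_nonneg (sub_nonneg.2 hlogZ) hη.le
end

section
/- Let d, N ∈ ℕ with d ≥ 1, let λ₀ ≥ 1, and let X₁, …, X_N be d×d real positive semidefinite matrices with tr(X_n) ≤ 1 for every n ∈ {1,…,N}. Define M₀ = λ₀·I_d and M_n = M_{n−1} + X_n for n = 1,…,N. Then Σ_{n=1}^N tr(X_n · M_{n−1}^{−1}) ≤ 2·log det(M_N) − 2·log det(M₀) ≤ 2·d·log(1 + N/(d·λ₀)). -/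
namespace Matrix

theorem posDef_of_sub_one_posSemidef {ι : Type*} [DecidableEq ι] {A : Matrix ι ι ℝ}
    (hA : (A - 1).PosSemidef) : A.PosDef := by
  simpa using PosDef.one.add_posSemidef hA

variable {ι : Type*} [Fintype ι] [DecidableEq ι]

theorem IsHermitian.det_one_add_eq_prod_eigenvalues {K : Matrix ι ι ℝ} (hK : K.IsHermitian) :
    (1 + K).det = ∏ i, (1 + hK.eigenvalues i) := by
  have h := congrArg (Polynomial.eval (-1)) hK.charpoly_eq
  have hneg : Matrix.scalar ι (-1 : ℝ) - K = -(1 + K) := by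
    rw [map_neg, map_one]
    abel
  have hfactor (i : ι) :
      Polynomial.eval (-1 : ℝ) (Polynomial.X - Polynomial.C (hK.eigenvalues i)) =
        (-1) * (1 + hK.eigenvalues i) := by
    simp
    ring
  rw [eval_charpoly, Polynomial.eval_prod, hneg, det_neg] at h
  simp only [RCLike.ofReal_real_eq_id, id] at h
  rw [Finset.prod_congr rfl fun i _ => hfactor i, Finset.prod_mul_distrib] at h
  simpa using h

theorem PosSemidef.one_add_trace_le_det_one_add {K : Matrix ι ι ℝ} (hK : K.PosSemidef) :
    1 + K.trace ≤ (1 + K).det := by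
  rw [hK.1.det_one_add_eq_prod_eigenvalues, hK.1.trace_eq_sum_eigenvalues]
  simp only [RCLike.ofReal_real_eq_id, id]
  induction (Finset.univ : Finset ι) using Finset.induction_on with
  | empty => simp
  | insert i s his ih =>
    rw [Finset.sum_insert his, Finset.prod_insert his]
    have hi := hK.eigenvalues_nonneg i
    have hs : 0 ≤ ∑ j ∈ s, hK.1.eigenvalues j :=
      Finset.sum_nonneg fun j _ => hK.eigenvalues_nonneg j
    nlinarith

open scoped MatrixOrder in
theorem PosSemidef.exists_eq_conjTranspose_mul_self {A : Matrix ι ι ℝ} (hA : A.PosSemidef) :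
    ∃ B : Matrix ι ι ℝ, A = Bᴴ * B :=
  CStarAlgebra.nonneg_iff_eq_star_mul_self.mp hA.nonneg

theorem one_sub_inv_posSemidef {A : Matrix ι ι ℝ} (hA : (A - 1).PosSemidef) :
    (1 - A⁻¹).PosSemidef := by
  have hdef := posDef_of_sub_one_posSemidef hA
  have hunit : IsUnit A.det := hdef.det_pos.ne'.isUnit
  have hsq : ((A - 1) * (A - 1)).PosSemidef := by
    have h := posSemidef_conjTranspose_mul_self (A - 1)
    rwa [hA.1.eq] at h
  have h := (hA.add hsq).mul_mul_conjTranspose_same A⁻¹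
  rw [hdef.inv.1.eq] at h
  have hid : A⁻¹ * ((A - 1) + (A - 1) * (A - 1)) * A⁻¹ = 1 - A⁻¹ := by
    have hpoly : (A - 1) + (A - 1) * (A - 1) = A * (A - 1) := by noncomm_ring
    rw [hpoly, ← mul_assoc, nonsing_inv_mul A hunit, one_mul, sub_mul,
      mul_nonsing_inv A hunit, one_mul]
  rwa [hid] at h

/-- A single step of the elliptical potential argument. -/
theorem trace_mul_inv_le_two_mul_log_det_sub {A X : Matrix ι ι ℝ} (hA : (A - 1).PosSemidef)
    (hX : X.PosSemidef) (htr : X.trace ≤ 1) :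
    (X * A⁻¹).trace ≤ 2 * Real.log (A + X).det - 2 * Real.log A.det := by
  have hdef := posDef_of_sub_one_posSemidef hA
  obtain ⟨B, rfl⟩ := hX.exists_eq_conjTranspose_mul_self
  have hK : (B * A⁻¹ * Bᴴ).PosSemidef := hdef.inv.posSemidef.mul_mul_conjTranspose_same B
  have htrK : (Bᴴ * B * A⁻¹).trace = (B * A⁻¹ * Bᴴ).trace := by
    rw [mul_assoc, trace_mul_comm]
  have hle : (B * A⁻¹ * Bᴴ).trace ≤ 1 := by
    have h := ((one_sub_inv_posSemidef hA).mul_mul_conjTranspose_same B).trace_nonneg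
    rw [mul_sub, sub_mul, mul_one, trace_sub, trace_mul_comm B] at h
    linarith
  have hdet := hK.one_add_trace_le_det_one_add
  have hnn := hK.trace_nonneg
  rw [htrK, det_add_mul _ _ hdef.det_pos.ne'.isUnit,
    Real.log_mul hdef.det_pos.ne' (by linarith)]
  set t := (B * A⁻¹ * Bᴴ).trace
  have hlog : t / 2 ≤ Real.log (1 + t) := by
    refine le_trans ?_ (Real.one_sub_inv_le_log_of_pos (by linarith))
    have hinv : 1 - (1 + t)⁻¹ = t / (1 + t) := by
      field_simp
      ring
    rw [hinv]
    exact div_le_div_of_nonneg_left hnn (by linarith) (by linarith)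
  have hmono := Real.log_le_log (by linarith) hdet
  linarith

theorem PosDef.log_det_le_card_mul_log {A : Matrix ι ι ℝ} (hA : A.PosDef) {c : ℝ} (hc : 0 < c)
    (htr : A.trace ≤ Fintype.card ι * c) :
    Real.log A.det ≤ Fintype.card ι * Real.log c := by
  have htr_eq := hA.1.trace_eq_sum_eigenvalues
  have hdet_eq := hA.1.det_eq_prod_eigenvalues
  simp only [RCLike.ofReal_real_eq_id, id] at htr_eq hdet_eq
  rw [hdet_eq, Real.log_prod fun i _ => (hA.eigenvalues_pos i).ne']
  have hterm (i : ι) :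
      Real.log (hA.1.eigenvalues i) ≤ hA.1.eigenvalues i / c - 1 + Real.log c := by
    have h := Real.log_le_sub_one_of_pos (div_pos (hA.eigenvalues_pos i) hc)
    rw [Real.log_div (hA.eigenvalues_pos i).ne' hc.ne'] at h
    linarith
  have hsum := Finset.sum_le_sum fun i (_ : i ∈ Finset.univ) => hterm i
  rw [Finset.sum_add_distrib, Finset.sum_sub_distrib, ← Finset.sum_div, ← htr_eq] at hsum
  simp only [Finset.sum_const, Finset.card_univ, nsmul_eq_mul, mul_one] at hsum
  have hdiv : A.trace / c ≤ Fintype.card ι := (div_le_iff₀ hc).2 htr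
  linarith

end Matrix

/-- Elliptical potential lemma. -/
theorem stmt_1 (d N : ℕ) (hd : 1 ≤ d) (lam0 : ℝ) (hlam0 : 1 ≤ lam0)
    (X M : ℕ → Matrix (Fin d) (Fin d) ℝ)
    (hX : ∀ n ∈ Finset.Icc 1 N, (X n).PosSemidef ∧ (X n).trace ≤ 1)
    (hM0 : M 0 = lam0 • (1 : Matrix (Fin d) (Fin d) ℝ))
    (hM : ∀ n ∈ Finset.Icc 1 N, M n = M (n - 1) + X n) :
    (∑ n ∈ Finset.Icc 1 N, (X n * (M (n - 1))⁻¹).trace ≤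
       2 * Real.log (M N).det - 2 * Real.log (M 0).det) ∧
    2 * Real.log (M N).det - 2 * Real.log (M 0).det ≤
      2 * (d : ℝ) * Real.log (1 + (N : ℝ) / ((d : ℝ) * lam0)) := by
  have key (n : ℕ) (hn : n ≤ N) : (M n - 1).PosSemidef ∧ (M n).trace ≤ d * lam0 + n ∧
      ∑ k ∈ Finset.Icc 1 n, (X k * (M (k - 1))⁻¹).trace ≤
        2 * Real.log (M n).det - 2 * Real.log (M 0).det := by
    induction n with
    | zero =>
      refine ⟨?_, ?_, by simp⟩
      · have h : M 0 - 1 = (lam0 - 1) • (1 : Matrix (Fin d) (Fin d) ℝ) := by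
          rw [hM0, sub_smul, one_smul]
        rw [h]
        exact Matrix.PosSemidef.one.smul (sub_nonneg.2 hlam0)
      · simp [hM0, mul_comm]
    | succ n ih =>
      obtain ⟨hpsd, htr, hsum⟩ := ih (by omega)
      have hmem : n + 1 ∈ Finset.Icc 1 N := Finset.mem_Icc.2 ⟨by omega, hn⟩
      obtain ⟨hXpsd, hXtr⟩ := hX _ hmem
      have hstep : M (n + 1) = M n + X (n + 1) := hM _ hmem
      refine ⟨?_, ?_, ?_⟩
      · rw [hstep, add_sub_right_comm]
        exact hpsd.add hXpsd
      · rw [hstep, Matrix.trace_add]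
        push_cast
        linarith
      · have h := Matrix.trace_mul_inv_le_two_mul_log_det_sub hpsd hXpsd hXtr
        rw [Finset.sum_Icc_succ_top (by omega), Nat.add_sub_cancel, hstep]
        linarith
  obtain ⟨hpsd, htr, hsum⟩ := key N le_rfl
  refine ⟨hsum, ?_⟩
  have hd_pos : (0 : ℝ) < d := by exact_mod_cast hd
  have hlam_pos : 0 < lam0 := by linarith
  have hratio : 0 < 1 + (N : ℝ) / (d * lam0) := by positivity
  have hlog := (Matrix.posDef_of_sub_one_posSemidef hpsd).log_det_le_card_mul_log
    (mul_pos hlam_pos hratio) (by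
      refine htr.trans_eq ?_
      rw [Fintype.card_fin]
      field_simp)
  rw [Fintype.card_fin, Real.log_mul hlam_pos.ne' hratio.ne'] at hlog
  have hdet0 : Real.log (M 0).det = d * Real.log lam0 := by
    rw [hM0, Matrix.det_smul, Matrix.det_one, mul_one, Real.log_pow, Fintype.card_fin]
  rw [hdet0]
  linarith
end

section
/- (Simulation lemma.) Let S and A be finite sets and H ∈ ℕ the horizon. Let P¹ = {P¹_h}_{h=1}^H and P² = {P²_h}_{h=1}^H be transition kernel sequences with P^i_h : S × A → Δ(S), let r¹ = {r¹_h}, r² = {r²_h} be reward sequences with r^i_h : S × A → ℝ, and let π = {π_h} be a policy. Then for every h ∈ {1,…,H} and every s ∈ S: V^π_{h,P¹,r¹}(s) − V^π_{h,P²,r²}(s) = Σ_{h′=h}^{H} E_{(s_{h′},a_{h′}) ∼ (P²,π) | s_h = s} [ r¹_{h′}(s_{h′},a_{h′}) − r²_{h′}(s_{h′},a_{h′}) + Σ_{s′∈S} ( P¹_{h′}(s′|s_{h′},a_{h′}) − P²_{h′}(s′|s_{h′},a_{h′}) ) · V^π_{h′+1,P¹,r¹}(s′) ], where E_{(s_{h′},a_{h′})∼(P²,π)|s_h=s}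 denotes expectation over the trajectory that starts at state s at step h and follows π under P². -/
/-- One step of the Bellman recursion for the difference of two value functions. -/
theorem bellman_difference {S A : Type*} [Fintype S] [Fintype A]
    (p : A → ℝ) (r1 r2 : A → ℝ) (P1 P2 : A → S → ℝ) (v1 v2 : S → ℝ) :
    ∑ a, p a * (r1 a + ∑ s, P1 a s * v1 s) - ∑ a, p a * (r2 a + ∑ s, P2 a s * v2 s) =
      ∑ a, p a * (r1 a - r2 a + ∑ s, (P1 a s - P2 a s) * v1 s) +
        ∑ a, p a * ∑ s, P2 a s * (v1 s - v2 s) := by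
  simp only [← Finset.sum_sub_distrib, ← Finset.sum_add_distrib, sub_mul, mul_sub]
  refine Finset.sum_congr rfl fun a _ => ?_
  simp only [Finset.sum_sub_distrib]
  ring

/-- Expectation under the pushforward of `d` by one step of the chain. -/
theorem sum_push_mul {S A : Type*} [Fintype S] [Fintype A]
    (d : S → ℝ) (p : S → A → ℝ) (P : S → A → S → ℝ) (f : S → ℝ) :
    ∑ s', (∑ s, ∑ a, d s * p s a * P s a s') * f s' =
      ∑ s, d s * ∑ a, p s a * ∑ s', P s a s' * f s' := by
  simp only [Finset.sum_mul, Finset.mul_sum]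
  rw [Finset.sum_comm]
  refine Finset.sum_congr rfl fun s _ => ?_
  rw [Finset.sum_comm]
  simp only [mul_assoc]

/-- Simulation lemma. -/
theorem stmt_5 {S A : Type*} [Fintype S] [Fintype A] [DecidableEq S]
    (H : ℕ)
    (P1 P2 : ℕ → S → A → S → ℝ)
    (hP1 : ∀ h ∈ Finset.Icc 1 H, ∀ s a, (∀ s', 0 ≤ P1 h s a s') ∧ ∑ s', P1 h s a s' = 1)
    (hP2 : ∀ h ∈ Finset.Icc 1 H, ∀ s a, (∀ s', 0 ≤ P2 h s a s') ∧ ∑ s', P2 h s a s' = 1)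
    (r1 r2 : ℕ → S → A → ℝ)
    (π : ℕ → S → A → ℝ)
    (hπ : ∀ h ∈ Finset.Icc 1 H, ∀ s, (∀ a, 0 ≤ π h s a) ∧ ∑ a, π h s a = 1)
    (V1 V2 : ℕ → S → ℝ)
    (hV1top : ∀ s, V1 (H + 1) s = 0)
    (hV2top : ∀ s, V2 (H + 1) s = 0)
    (hV1 : ∀ h ∈ Finset.Icc 1 H, ∀ s,
      V1 h s = ∑ a, π h s a * (r1 h s a + ∑ s', P1 h s a s' * V1 (h + 1) s'))
    (hV2 : ∀ h ∈ Finset.Icc 1 H, ∀ s,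
      V2 h s = ∑ a, π h s a * (r2 h s a + ∑ s', P2 h s a s' * V2 (h + 1) s'))
    -- `D h s h' s'` : probability of being at state `s'` at step `h'`, for the trajectory
    -- started at state `s` at step `h` that follows `π` under the kernels `P2`.
    (D : ℕ → S → ℕ → S → ℝ)
    (hDinit : ∀ h s s', D h s h s' = if s' = s then 1 else 0)
    (hDstep : ∀ h s, ∀ h' ∈ Finset.Icc h H, ∀ s'',
      D h s (h' + 1) s'' = ∑ s', ∑ a, D h s h' s' * π h' s' a * P2 h' s' a s'') :
    ∀ h ∈ Finset.Icc 1 H, ∀ s,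
      V1 h s - V2 h s =
        ∑ h' ∈ Finset.Icc h H, ∑ s', D h s h' s' *
          ∑ a, π h' s' a *
            (r1 h' s' a - r2 h' s' a +
              ∑ s'', (P1 h' s' a s'' - P2 h' s' a s'') * V1 (h' + 1) s'') := by
  intro h hh s
  obtain ⟨h1, hH⟩ := Finset.mem_Icc.mp hh
  set W : ℕ → ℝ := fun k => ∑ s', D h s k s' * (V1 k s' - V2 k s') with hW
  have start : W h = V1 h s - V2 h s := by simp [hW, hDinit]
  have finish : W (H + 1) = 0 := by simp [hW, hV1top, hV2top]
  have step : ∀ k ∈ Finset.Icc h H, ∑ s', D h s k s' *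
      ∑ a, π k s' a * (r1 k s' a - r2 k s' a +
        ∑ s'', (P1 k s' a s'' - P2 k s' a s'') * V1 (k + 1) s'') = -(W (k + 1) - W k) := by
    intro k hk
    have hk1 : k ∈ Finset.Icc 1 H := by
      rw [Finset.mem_Icc] at hk ⊢
      omega
    simp only [hW, hDstep h s k hk, sum_push_mul, hV1 k hk1, hV2 k hk1, bellman_difference,
      mul_add (D h s k _), Finset.sum_add_distrib]
    ring
  rw [Finset.sum_congr rfl step, Finset.sum_neg_distrib, ← Finset.Ico_add_one_right_eq_Icc,
    Finset.sum_Ico_sub W (by omega), start, finish]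
  ring
end

section
/- Let S and A be finite sets and H ∈ ℕ the horizon. Let P = {P_h} and P̂ = {P̂_h} be transition kernel sequences S × A → Δ(S), and let r = {r_h} be rewards with r_h : S × A → [0,1] satisfying Σ_{h=1}^H max_{(s,a)} r_h(s,a) ≤ 1 (so every value function takes values in [0,1]). Define f_h(s,a) = ‖P̂_h(·|s,a) − P_h(·|s,a)‖_TV. Then for every policy π and every initial state s₁ ∈ S: |V^π_{1,P,r}(s₁) − V^π_{1,P̂,r}(s₁)| ≤ V̂^π_{1,P̂,f}(s₁), where V̂^π_{1,P̂,f} is the truncated value function under P̂ with bonus sequence f = {f_h}. -/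
/-- A weighted average of points of `[a, b]` lies in `[a, b]`. -/
lemma weighted_sum_mem_Icc {ι : Type*} [Fintype ι] {w x : ι → ℝ} {a b : ℝ}
    (hw : (∀ i, 0 ≤ w i) ∧ ∑ i, w i = 1) (hx : ∀ i, x i ∈ Set.Icc a b) :
    ∑ i, w i * x i ∈ Set.Icc a b :=
  (convex_Icc a b).sum_mem (fun i _ => hw.1 i) hw.2 (fun i _ => hx i)

/-- Expectations of a `[0, 1]`-valued function under two probability vectors differ by at most
their total variation distance. -/
lemma abs_sum_mul_sub_sum_mul_le_tv {ι : Type*} [Fintype ι] {p q v : ι → ℝ}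
    (hp : ∑ i, p i = 1) (hq : ∑ i, q i = 1) (hv : ∀ i, v i ∈ Set.Icc (0 : ℝ) 1) :
    |∑ i, p i * v i - ∑ i, q i * v i| ≤ (1 / 2) * ∑ i, |q i - p i| := by
  have hcenter : ∑ i, p i * v i - ∑ i, q i * v i = ∑ i, (p i - q i) * (v i - 1 / 2) := by
    simp only [mul_sub, sub_mul, Finset.sum_sub_distrib, ← Finset.sum_mul, hp, hq]
    ring
  rw [hcenter, Finset.mul_sum]
  refine (Finset.abs_sum_le_sum_abs _ _).trans (Finset.sum_le_sum fun i _ => ?_)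
  rw [abs_mul, abs_sub_comm (p i), mul_comm]
  refine mul_le_mul_of_nonneg_right (abs_le.2 ⟨?_, ?_⟩) (abs_nonneg _)
  · linarith [(hv i).1]
  · linarith [(hv i).2]

/-- The values of a policy from stage `h` on lie between `0` and the sum of the remaining
stagewise reward bounds `m`. -/
lemma value_mem_Icc {S A : Type*} [Fintype S] [Fintype A] {H : ℕ} {P : ℕ → S → A → S → ℝ}
    (hP : ∀ h ∈ Finset.Icc 1 H, ∀ s a, (∀ s', 0 ≤ P h s a s') ∧ ∑ s', P h s a s' = 1)
    {r : ℕ → S → A → ℝ} {m : ℕ → ℝ}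
    (hr : ∀ h ∈ Finset.Icc 1 H, ∀ s a, r h s a ∈ Set.Icc 0 (m h))
    {π : ℕ → S → A → ℝ}
    (hπ : ∀ h ∈ Finset.Icc 1 H, ∀ s, (∀ a, 0 ≤ π h s a) ∧ ∑ a, π h s a = 1)
    {V : ℕ → S → ℝ} (hVtop : ∀ s, V (H + 1) s = 0)
    (hV : ∀ h ∈ Finset.Icc 1 H, ∀ s,
      V h s = ∑ a, π h s a * (r h s a + ∑ s', P h s a s' * V (h + 1) s'))
    {h : ℕ} (h1 : 1 ≤ h) (hH : h ≤ H + 1) :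
    ∀ s, V h s ∈ Set.Icc 0 (∑ k ∈ Finset.Icc h H, m k) := by
  refine Nat.decreasingInduction' (P := fun h => ∀ s, V h s ∈ Set.Icc 0 (∑ k ∈ Finset.Icc h H, m k))
    (fun k hk hhk ih s => ?_) hH (fun s => by simp [hVtop])
  have hmem : k ∈ Finset.Icc 1 H := Finset.mem_Icc.2 ⟨by omega, by omega⟩
  rw [hV k hmem s]
  refine weighted_sum_mem_Icc (hπ k hmem s) fun a => ?_
  have hnext := weighted_sum_mem_Icc (hP k hmem s a) ih
  have hsplit : ∑ j ∈ Finset.Icc k H, m j = m k + ∑ j ∈ Finset.Icc (k + 1) H, m j := by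
    rw [← Finset.insert_Icc_add_one_left_eq_Icc (by omega), Finset.sum_insert (by simp)]
  rw [hsplit]
  exact ⟨add_nonneg (hr k hmem s a).1 hnext.1, add_le_add (hr k hmem s a).2 hnext.2⟩

/-- Bounded difference of value functions: the value gap between the true and the estimated
model is bounded by the truncated value function with the TV-error bonuses. -/
theorem stmt_7 {S A : Type*} [Fintype S] [Fintype A] [Nonempty S] [Nonempty A]
    (H : ℕ)
    (P Phat : ℕ → S → A → S → ℝ)
    (hP : ∀ h ∈ Finset.Icc 1 H, ∀ s a, (∀ s', 0 ≤ P h s a s') ∧ ∑ s', P h s a s' = 1)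
    (hPhat : ∀ h ∈ Finset.Icc 1 H, ∀ s a, (∀ s', 0 ≤ Phat h s a s') ∧ ∑ s', Phat h s a s' = 1)
    (r : ℕ → S → A → ℝ)
    (hr : ∀ h ∈ Finset.Icc 1 H, ∀ s a, 0 ≤ r h s a ∧ r h s a ≤ 1)
    (hrsum : ∑ h ∈ Finset.Icc 1 H,
      Finset.univ.sup' Finset.univ_nonempty (fun sa : S × A => r h sa.1 sa.2) ≤ 1)
    (f : ℕ → S → A → ℝ)
    (hf : ∀ h s a, f h s a = (1 / 2) * ∑ s', |Phat h s a s' - P h s a s'|)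
    (π : ℕ → S → A → ℝ)
    (hπ : ∀ h ∈ Finset.Icc 1 H, ∀ s, (∀ a, 0 ≤ π h s a) ∧ ∑ a, π h s a = 1)
    -- value functions of `π` under `(P, r)` and `(Phat, r)`
    (V Vhat : ℕ → S → ℝ)
    (hVtop : ∀ s, V (H + 1) s = 0)
    (hV : ∀ h ∈ Finset.Icc 1 H, ∀ s,
      V h s = ∑ a, π h s a * (r h s a + ∑ s', P h s a s' * V (h + 1) s'))
    (hVhattop : ∀ s, Vhat (H + 1) s = 0)
    (hVhat : ∀ h ∈ Finset.Icc 1 H, ∀ s,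
      Vhat h s = ∑ a, π h s a * (r h s a + ∑ s', Phat h s a s' * Vhat (h + 1) s'))
    -- truncated value function of `π` under `Phat` with bonus `f`
    (Vt : ℕ → S → ℝ)
    (hVttop : ∀ s, Vt (H + 1) s = 0)
    (hVt : ∀ h ∈ Finset.Icc 1 H, ∀ s,
      Vt h s = ∑ a, π h s a * min 1 (f h s a + ∑ s', Phat h s a s' * Vt (h + 1) s'))
    (s₁ : S) :
    |V 1 s₁ - Vhat 1 s₁| ≤ Vt 1 s₁ := by
  set m : ℕ → ℝ := fun h =>
    Finset.univ.sup' Finset.univ_nonempty (fun sa : S × A => r h sa.1 sa.2)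
  have hrm : ∀ h ∈ Finset.Icc 1 H, ∀ s a, r h s a ∈ Set.Icc 0 (m h) := fun h hh s a =>
    ⟨(hr h hh s a).1,
      Finset.le_sup' (fun sa : S × A => r h sa.1 sa.2) (Finset.mem_univ (s, a))⟩
  have hm : ∀ h ∈ Finset.Icc 1 H, 0 ≤ m h := fun h hh =>
    have hmem := hrm h hh s₁ (Classical.arbitrary A)
    hmem.1.trans hmem.2
  have htail : ∀ h, 1 ≤ h → ∑ k ∈ Finset.Icc h H, m k ≤ 1 := fun h h1 =>
    (Finset.sum_le_sum_of_subset_of_nonneg (Finset.Icc_subset_Icc_left h1)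
      fun k hk _ => hm k hk).trans hrsum
  refine Nat.decreasingInduction' (P := fun h => ∀ s, |V h s - Vhat h s| ≤ Vt h s)
    (fun h hh h1 ih s => ?_) (Nat.le_add_left 1 H)
    (fun s => by simp [hVtop, hVhattop, hVttop]) s₁
  have hmem : h ∈ Finset.Icc 1 H := Finset.mem_Icc.2 ⟨h1, by omega⟩
  have hVmem := value_mem_Icc hP hrm hπ hVtop hV (h := h + 1) (by omega) (by omega)
  have hVhatmem := value_mem_Icc hPhat hrm hπ hVhattop hVhat (h := h + 1) (by omega) (by omega)
  have hsplit : ∑ j ∈ Finset.Icc h H, m j = m h + ∑ j ∈ Finset.Icc (h + 1) H, m j := by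
    rw [← Finset.insert_Icc_add_one_left_eq_Icc (by omega), Finset.sum_insert (by simp)]
  rw [hV h hmem, hVhat h hmem, hVt h hmem, ← Finset.sum_sub_distrib]
  refine (Finset.abs_sum_le_sum_abs _ _).trans (Finset.sum_le_sum fun a _ => ?_)
  rw [← mul_sub, abs_mul, abs_of_nonneg ((hπ h hmem s).1 a)]
  refine mul_le_mul_of_nonneg_left (le_min ?_ ?_) ((hπ h hmem s).1 a)
  · obtain ⟨hQ0, hQ1⟩ := weighted_sum_mem_Icc (hP h hmem s a) hVmem
    obtain ⟨hQhat0, hQhat1⟩ := weighted_sum_mem_Icc (hPhat h hmem s a) hVhatmem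
    have hle := htail h h1
    have hmh := hm h hmem
    rw [abs_le]
    constructor <;> linarith
  · have htv := abs_sum_mul_sub_sum_mul_le_tv (hP h hmem s a).2 (hPhat h hmem s a).2
      fun s' => ⟨(hVmem s').1, (hVmem s').2.trans (htail (h + 1) (by omega))⟩
    rw [← hf] at htv
    have hrec : |∑ s', Phat h s a s' * V (h + 1) s' - ∑ s', Phat h s a s' * Vhat (h + 1) s'| ≤
        ∑ s', Phat h s a s' * Vt (h + 1) s' := by
      rw [← Finset.sum_sub_distrib]
      refine (Finset.abs_sum_le_sum_abs _ _).trans (Finset.sum_le_sum fun s' _ => ?_)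
      rw [← mul_sub, abs_mul, abs_of_nonneg ((hPhat h hmem s a).1 s')]
      exact mul_le_mul_of_nonneg_left (ih s') ((hPhat h hmem s a).1 s')
    rw [add_sub_add_left_eq_sub]
    exact (abs_sub_le _ _ _).trans (add_le_add htv hrec)
end

section
/- Let S and A be finite sets and H ∈ ℕ the horizon. Let P = {P_h} and P̂ = {P̂_h} be transition kernel sequences S × A → Δ(S), let b = {b_h} be bonuses with b_h : S × A → [0,1], and define f_h(s,a) = ‖P̂_h(·|s,a) − P_h(·|s,a)‖_TV. Then for every policy π and every initial state s₁ ∈ S: V̂^π_{1,P̂,b}(s₁) ≤ V^π_{1,P,b}(s₁) + V^π_{1,P,f}(s₁), where V̂^π_{1,P̂,b} is the truncated value function under P̂ with bonus b, and V^π_{1,P,b}, V^π_{1,P,f} are the (untruncated) value functions under P with reward sequences b and f respectively. -/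
/-- Expectations of a `[0, 1]`-valued function under two probability vectors differ by at most
their total variation distance. -/
theorem sum_mul_le_sum_mul_add_tv {S : Type*} [Fintype S] {p q v : S → ℝ}
    (hpq : ∑ s, p s = ∑ s, q s) (hv0 : ∀ s, 0 ≤ v s) (hv1 : ∀ s, v s ≤ 1) :
    ∑ s, p s * v s ≤ ∑ s, q s * v s + (1 / 2) * ∑ s, |p s - q s| := by
  have hpoint : ∀ s, p s * v s ≤ q s * v s + (1 / 2) * |p s - q s| + (1 / 2) * (p s - q s) := by
    intro s
    rcases abs_cases (p s - q s) with ⟨h, h'⟩ | ⟨h, h'⟩ <;> rw [h] <;>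
      nlinarith [hv0 s, hv1 s]
  have hsum := Finset.sum_le_sum fun s (_ : s ∈ Finset.univ) => hpoint s
  simp only [Finset.sum_add_distrib, ← Finset.mul_sum, Finset.sum_sub_distrib] at hsum
  linarith

/-- The truncated value function under the estimated model with bonus `b` is bounded by the
value function under the true model with reward `b` plus the value function under the true
model with reward given by the TV model errors `f`. -/
theorem stmt_8 {S A : Type*} [Fintype S] [Fintype A]
    (H : ℕ)
    (P Phat : ℕ → S → A → S → ℝ)
    (hP : ∀ h ∈ Finset.Icc 1 H, ∀ s a, (∀ s', 0 ≤ P h s a s') ∧ ∑ s', P h s a s' = 1)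
    (hPhat : ∀ h ∈ Finset.Icc 1 H, ∀ s a, (∀ s', 0 ≤ Phat h s a s') ∧ ∑ s', Phat h s a s' = 1)
    (b : ℕ → S → A → ℝ)
    (hb : ∀ h ∈ Finset.Icc 1 H, ∀ s a, 0 ≤ b h s a ∧ b h s a ≤ 1)
    (f : ℕ → S → A → ℝ)
    (hf : ∀ h s a, f h s a = (1 / 2) * ∑ s', |Phat h s a s' - P h s a s'|)
    (π : ℕ → S → A → ℝ)
    (hπ : ∀ h ∈ Finset.Icc 1 H, ∀ s, (∀ a, 0 ≤ π h s a) ∧ ∑ a, π h s a = 1)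
    -- truncated value function of `π` under `Phat` with bonus `b`
    (Vt : ℕ → S → ℝ)
    (hVttop : ∀ s, Vt (H + 1) s = 0)
    (hVt : ∀ h ∈ Finset.Icc 1 H, ∀ s,
      Vt h s = ∑ a, π h s a * min 1 (b h s a + ∑ s', Phat h s a s' * Vt (h + 1) s'))
    -- value function of `π` under `(P, b)`
    (Vb : ℕ → S → ℝ)
    (hVbtop : ∀ s, Vb (H + 1) s = 0)
    (hVb : ∀ h ∈ Finset.Icc 1 H, ∀ s,
      Vb h s = ∑ a, π h s a * (b h s a + ∑ s', P h s a s' * Vb (h + 1) s'))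
    -- value function of `π` under `(P, f)`
    (Vf : ℕ → S → ℝ)
    (hVftop : ∀ s, Vf (H + 1) s = 0)
    (hVf : ∀ h ∈ Finset.Icc 1 H, ∀ s,
      Vf h s = ∑ a, π h s a * (f h s a + ∑ s', P h s a s' * Vf (h + 1) s'))
    (s₁ : S) :
    Vt 1 s₁ ≤ Vb 1 s₁ + Vf 1 s₁ := by
  have key : ∀ k h, h + k = H + 1 → 1 ≤ h →
      ∀ s, 0 ≤ Vt h s ∧ Vt h s ≤ 1 ∧ Vt h s ≤ Vb h s + Vf h s := by
    intro k
    induction k with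
    | zero =>
      rintro h rfl - s
      simp [hVttop, hVbtop, hVftop]
    | succ k ih =>
      intro h hk h1 s
      have hmem : h ∈ Finset.Icc 1 H := Finset.mem_Icc.mpr ⟨h1, by omega⟩
      have ih := ih (h + 1) (by omega) (by omega)
      obtain ⟨hπ0, hπ1⟩ := hπ h hmem s
      rw [hVt h hmem s]
      refine ⟨?_, ?_, ?_⟩
      · refine Finset.sum_nonneg fun a _ => mul_nonneg (hπ0 a) (le_min zero_le_one ?_)
        exact add_nonneg (hb h hmem s a).1 (Finset.sum_nonneg fun s' _ =>
          mul_nonneg ((hPhat h hmem s a).1 s') (ih s').1)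
      · exact (Finset.sum_le_sum fun a _ =>
          mul_le_of_le_one_right (hπ0 a) (min_le_left _ _)).trans_eq hπ1
      · rw [hVb h hmem s, hVf h hmem s, ← Finset.sum_add_distrib]
        refine Finset.sum_le_sum fun a _ => ?_
        rw [← mul_add]
        refine mul_le_mul_of_nonneg_left ((min_le_right _ _).trans ?_) (hπ0 a)
        have htv := sum_mul_le_sum_mul_add_tv
          ((hPhat h hmem s a).2.trans (hP h hmem s a).2.symm)
          (fun s' => (ih s').1) (fun s' => (ih s').2.1)
        have hle : ∑ s', P h s a s' * Vt (h + 1) s' ≤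
            ∑ s', P h s a s' * Vb (h + 1) s' + ∑ s', P h s a s' * Vf (h + 1) s' := by
          rw [← Finset.sum_add_distrib]
          refine Finset.sum_le_sum fun s' _ => ?_
          rw [← mul_add]
          exact mul_le_mul_of_nonneg_left (ih s').2.2 ((hP h hmem s a).1 s')
        rw [hf]
        linarith
  exact (key H 1 (by omega) le_rfl s₁).2.2
end

section
/- (Mirror-descent regret with periodic restarts.) Let S and A be finite sets, H, K, L, τ ∈ ℕ with K = L·τ, and η > 0. For each k ∈ {1,…,K} and h ∈ {1,…,H} let Q̂^k_h : S × A → [0,1]. Let the policies π^k = {π^k_h} be generated as follows: whenever k ≡ 1 (mod τ), π^k_h(·|s) is the uniform distribution on A for all h, s; otherwise π^{k}_h(a|s) = π^{k−1}_h(a|s)·exp(η·Q̂^{k−1}_h(s,a)) / Σ_{a′} π^{k−1}_h(a′|s)·exp(η·Q̂^{k−1}_h(s,a′)). Let π^{⋆,1}, …, π^{⋆,K} be arbitrary comparator policies, and for each block l ∈ {1,…,L} and step h let ρ_{l,h} be an arbitrary probability distribution on S. Then Σ_{l=1}^{L} Σ_{k=(l−1)τ+1}^{lτ} Σ_{h=1}^{H}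 E_{s∼ρ_{l,h}} [ Σ_{a∈A} Q̂^k_h(s,a)·( π^{⋆,k}_h(a|s) − π^k_h(a|s) ) ] ≤ (η·K·H)/2 + (L·H·log|A|)/η + τ·Δ^π, where Δ^π = Σ_{k=2}^{K} Σ_{h=1}^{H} max_{s∈S} ‖π^{⋆,k}_h(·|s) − π^{⋆,k−1}_h(·|s)‖_TV. -/
/-- The exponential-weights (Hedge) iterates for the gains `q`, started at the uniform weights. -/
noncomputable def expWeights {A : Type*} [Fintype A] (η : ℝ) (q : ℕ → A → ℝ) : ℕ → A → ℝ
  | 0 => fun _ => 1 / (Fintype.card A : ℝ)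
  | t + 1 => fun a => expWeights η q t a * Real.exp (η * q t a) /
      ∑ a', expWeights η q t a' * Real.exp (η * q t a')

theorem expWeights_pos {A : Type*} [Fintype A] [Nonempty A] (η : ℝ) (q : ℕ → A → ℝ) (t : ℕ)
    (a : A) : 0 < expWeights η q t a := by
  induction t generalizing a with
  | zero => simp only [expWeights]; positivity
  | succ t ih =>
    simp only [expWeights]
    exact div_pos (mul_pos (ih a) (Real.exp_pos _))
      (Finset.sum_pos (fun b _ => mul_pos (ih b) (Real.exp_pos _)) Finset.univ_nonempty)

theorem sum_expWeights {A : Type*} [Fintype A] [Nonempty A] (η : ℝ) (q : ℕ → A → ℝ) (t : ℕ) :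
    ∑ a, expWeights η q t a = 1 := by
  cases t with
  | zero => simp [expWeights]
  | succ t =>
    simp only [expWeights]
    rw [← Finset.sum_div]
    exact div_self (Finset.sum_pos (fun b _ => mul_pos (expWeights_pos η q t b) (Real.exp_pos _))
      Finset.univ_nonempty).ne'

theorem exp_neg_le_quadratic {x : ℝ} (hx : 0 ≤ x) : Real.exp (-x) ≤ 1 - x + x ^ 2 / 2 := by
  have h := Real.quadratic_le_exp_of_nonneg hx
  rw [Real.exp_neg, inv_le_iff_one_le_mul₀ (Real.exp_pos x)]
  have h0 : 0 ≤ 1 - x + x ^ 2 / 2 := by nlinarith [sq_nonneg (x - 1)]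
  nlinarith [mul_le_mul_of_nonneg_left h h0, sq_nonneg (x ^ 2)]

/-- The log-moment-generating function of a `[0, 1]`-valued variable. -/
theorem log_sum_mul_exp_le {A : Type*} [Fintype A] {η : ℝ} (hη : 0 < η)
    {w q : A → ℝ} (hw : ∀ a, 0 ≤ w a) (hw1 : ∑ a, w a = 1)
    (hq : ∀ a, 0 ≤ q a ∧ q a ≤ 1) (hpos : 0 < ∑ a, w a * Real.exp (η * q a)) :
    Real.log (∑ a, w a * Real.exp (η * q a)) ≤ η * ∑ a, q a * w a + η ^ 2 / 2 := by
  rw [Real.log_le_iff_le_exp hpos]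
  have hterm : ∀ a, w a * Real.exp (η * q a) ≤
      Real.exp η * ((1 - η + η ^ 2 / 2) * w a + η * (q a * w a)) := by
    intro a
    obtain ⟨h0, h1⟩ := hq a
    have he : Real.exp (η * q a) = Real.exp η * Real.exp (-(η * (1 - q a))) := by
      rw [← Real.exp_add]; congr 1; ring
    have hb := exp_neg_le_quadratic (x := η * (1 - q a)) (mul_nonneg hη.le (by linarith))
    have hc : (η * (1 - q a)) ^ 2 ≤ η ^ 2 := by
      rw [mul_pow]; exact mul_le_of_le_one_right (sq_nonneg _) (by nlinarith)
    have hd : Real.exp (-(η * (1 - q a))) ≤ 1 - η + η ^ 2 / 2 + η * q a := by linarith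
    rw [he]
    have := mul_le_mul_of_nonneg_left hd (mul_nonneg (hw a) (Real.exp_pos η).le)
    linarith
  calc ∑ a, w a * Real.exp (η * q a)
      ≤ ∑ a, Real.exp η * ((1 - η + η ^ 2 / 2) * w a + η * (q a * w a)) :=
        Finset.sum_le_sum fun a _ => hterm a
    _ = Real.exp η * ((η * ∑ a, q a * w a + η ^ 2 / 2 - η) + 1) := by
        rw [← Finset.mul_sum, Finset.sum_add_distrib, ← Finset.mul_sum, ← Finset.mul_sum, hw1]
        ring
    _ ≤ Real.exp η * Real.exp (η * ∑ a, q a * w a + η ^ 2 / 2 - η) :=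
        mul_le_mul_of_nonneg_left (Real.add_one_le_exp _) (Real.exp_pos η).le
    _ = Real.exp (η * ∑ a, q a * w a + η ^ 2 / 2) := by
        rw [← Real.exp_add]; congr 1; ring

/-- Regret of exponential weights against a fixed comparator. -/
theorem expWeights_regret {A : Type*} [Fintype A] [Nonempty A] {η : ℝ} (hη : 0 < η)
    {q : ℕ → A → ℝ} {p : A → ℝ} (hp : ∀ a, 0 ≤ p a) (hp1 : ∑ a, p a = 1) (n : ℕ)
    (hq : ∀ t < n, ∀ a, 0 ≤ q t a ∧ q t a ≤ 1) :
    ∑ t ∈ Finset.range n, ∑ a, q t a * (p a - expWeights η q t a) ≤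
      η * n / 2 + Real.log (Fintype.card A) / η := by
  have hpot : ∀ m ≤ n, η * ∑ t ∈ Finset.range m, ∑ a, q t a * (p a - expWeights η q t a) ≤
      m * (η ^ 2 / 2) + Real.log (Fintype.card A) + ∑ a, p a * Real.log (expWeights η q m a) := by
    intro m
    induction m with
    | zero =>
      intro _
      simp [expWeights, ← Finset.sum_mul, hp1]
    | succ m ih =>
      intro hm
      have hw := expWeights_pos η q m
      have hZ : 0 < ∑ a, expWeights η q m a * Real.exp (η * q m a) :=
        Finset.sum_pos (fun b _ => mul_pos (hw b) (Real.exp_pos _)) Finset.univ_nonempty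
      have hlog := log_sum_mul_exp_le hη (fun a => (hw a).le) (sum_expWeights η q m)
        (hq m (by omega)) hZ
      have hstep : ∑ a, p a * Real.log (expWeights η q (m + 1) a) =
          ∑ a, p a * Real.log (expWeights η q m a) + η * ∑ a, q m a * p a -
            Real.log (∑ a, expWeights η q m a * Real.exp (η * q m a)) := by
        have : ∀ a, p a * Real.log (expWeights η q (m + 1) a) =
            p a * Real.log (expWeights η q m a) + η * (q m a * p a) -
              p a * Real.log (∑ a, expWeights η q m a * Real.exp (η * q m a)) := by
          intro a
          rw [expWeights, Real.log_div (mul_pos (hw a) (Real.exp_pos _)).ne' hZ.ne',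
            Real.log_mul (hw a).ne' (Real.exp_pos _).ne', Real.log_exp]
          ring
        simp only [this]
        rw [Finset.sum_sub_distrib, Finset.sum_add_distrib, ← Finset.mul_sum, ← Finset.sum_mul,
          hp1, one_mul]
      have hih := ih (by omega)
      rw [Finset.sum_range_succ, mul_add, hstep]
      simp only [mul_sub, Finset.sum_sub_distrib] at hih ⊢
      push_cast
      linarith
  have hneg : ∑ a, p a * Real.log (expWeights η q n a) ≤ 0 := by
    refine Finset.sum_nonpos fun a _ => mul_nonpos_of_nonneg_of_nonpos (hp a) ?_
    refine Real.log_nonpos (expWeights_pos η q n a).le ?_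
    rw [← sum_expWeights η q n]
    exact Finset.single_le_sum (fun b _ => (expWeights_pos η q n b).le) (Finset.mem_univ a)
  have hfin := hpot n le_rfl
  refine le_of_mul_le_mul_left ?_ hη
  have : η * (η * n / 2 + Real.log (Fintype.card A) / η) =
      n * (η ^ 2 / 2) + Real.log (Fintype.card A) := by
    field_simp
  rw [this]
  linarith

/-- A `[0, 1]`-valued function has expectations that differ by at most the total variation. -/
theorem sum_mul_sub_le_half_sum_abs {A : Type*} [Fintype A] {q u v : A → ℝ}
    (hq : ∀ a, 0 ≤ q a ∧ q a ≤ 1) (huv : ∑ a, u a = ∑ a, v a) :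
    ∑ a, q a * (u a - v a) ≤ 1 / 2 * ∑ a, |u a - v a| := by
  have hcenter : ∑ a, q a * (u a - v a) = ∑ a, (q a - 1 / 2) * (u a - v a) := by
    simp only [sub_mul, Finset.sum_sub_distrib, ← Finset.mul_sum, huv]
    ring
  rw [hcenter, Finset.mul_sum]
  refine Finset.sum_le_sum fun a _ => ?_
  obtain ⟨h0, h1⟩ := hq a
  calc (q a - 1 / 2) * (u a - v a) ≤ |q a - 1 / 2| * |u a - v a| := by
        rw [← abs_mul]; exact le_abs_self _
    _ ≤ 1 / 2 * |u a - v a| :=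
        mul_le_mul_of_nonneg_right (abs_le.2 ⟨by linarith, by linarith⟩) (abs_nonneg _)

theorem half_sum_abs_sub_le_sum_range {A : Type*} [Fintype A] {p : ℕ → A → ℝ} {M : ℕ → ℝ} (t : ℕ)
    (hM : ∀ j < t, 1 / 2 * ∑ a, |p (j + 1) a - p j a| ≤ M j) :
    1 / 2 * ∑ a, |p t a - p 0 a| ≤ ∑ j ∈ Finset.range t, M j := by
  induction t with
  | zero => simp
  | succ t ih =>
    have h1 := ih fun j hj => hM j (by omega)
    have h2 := hM t (by omega)
    have h3 : ∑ a, |p (t + 1) a - p 0 a| ≤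
        ∑ a, |p (t + 1) a - p t a| + ∑ a, |p t a - p 0 a| := by
      rw [← Finset.sum_add_distrib]
      exact Finset.sum_le_sum fun a _ => abs_sub_le _ _ _
    rw [Finset.sum_range_succ]
    linarith

/-- Regret of exponential weights against a drifting comparator. -/
theorem expWeights_tracking_regret {A : Type*} [Fintype A] [Nonempty A] {η : ℝ} (hη : 0 < η)
    {q p : ℕ → A → ℝ} {M : ℕ → ℝ} (n : ℕ)
    (hp : ∀ t < n, (∀ a, 0 ≤ p t a) ∧ ∑ a, p t a = 1)
    (hq : ∀ t < n, ∀ a, 0 ≤ q t a ∧ q t a ≤ 1) (hM0 : ∀ j, 0 ≤ M j)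
    (hM : ∀ j < n - 1, 1 / 2 * ∑ a, |p (j + 1) a - p j a| ≤ M j) :
    ∑ t ∈ Finset.range n, ∑ a, q t a * (p t a - expWeights η q t a) ≤
      η * n / 2 + Real.log (Fintype.card A) / η + n * ∑ j ∈ Finset.range (n - 1), M j := by
  rcases Nat.eq_zero_or_pos n with rfl | hn
  · simpa using div_nonneg (Real.log_natCast_nonneg _) hη.le
  have hfix := expWeights_regret hη (hp 0 hn).1 (hp 0 hn).2 n hq
  have hdrift : ∑ t ∈ Finset.range n, ∑ a, q t a * (p t a - p 0 a) ≤
      n * ∑ j ∈ Finset.range (n - 1), M j := by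
    rw [← nsmul_eq_mul]
    nth_rewrite 2 [← Finset.card_range n]
    refine Finset.sum_le_card_nsmul _ _ _ fun t ht => ?_
    rw [Finset.mem_range] at ht
    refine (sum_mul_sub_le_half_sum_abs (hq t ht) ((hp t ht).2.trans (hp 0 hn).2.symm)).trans ?_
    refine (half_sum_abs_sub_le_sum_range t fun j hj => hM j (by omega)).trans ?_
    exact Finset.sum_le_sum_of_subset_of_nonneg (Finset.range_subset_range.2 (by omega))
      fun j _ _ => hM0 j
  have hsplit : ∑ t ∈ Finset.range n, ∑ a, q t a * (p t a - expWeights η q t a) =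
      ∑ t ∈ Finset.range n, ∑ a, q t a * (p 0 a - expWeights η q t a) +
        ∑ t ∈ Finset.range n, ∑ a, q t a * (p t a - p 0 a) := by
    simp only [← Finset.sum_add_distrib]
    refine Finset.sum_congr rfl fun t _ => Finset.sum_congr rfl fun a _ => ?_
    ring
  linarith

theorem sum_Icc_add_eq_sum_range {M : Type*} [AddCommMonoid M] (m n : ℕ) (f : ℕ → M) :
    ∑ k ∈ Finset.Icc (m + 1) (m + n), f k = ∑ t ∈ Finset.range n, f (m + 1 + t) := by
  rw [← Finset.Ico_add_one_right_eq_Icc, Finset.sum_Ico_eq_sum_range]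
  congr 2
  omega

theorem sum_blocks_le {g : ℕ → ℝ} (hg : ∀ j, 0 ≤ g j) (L τ : ℕ) :
    ∑ i ∈ Finset.range L, ∑ j ∈ Finset.range (τ - 1), g (i * τ + j) ≤
      ∑ j ∈ Finset.range (L * τ - 1), g j := by
  rcases Nat.eq_zero_or_pos τ with rfl | hτ
  · simp
  induction L with
  | zero => simp
  | succ L ih =>
    have hlen : (L + 1) * τ - 1 = L * τ + (τ - 1) := by
      rw [Nat.succ_mul]; omega
    rw [Finset.sum_range_succ, hlen, Finset.sum_range_add]
    gcongr
    exact ih.trans (Finset.sum_le_sum_of_subset_of_nonneg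
      (Finset.range_subset_range.2 (by omega)) fun j _ _ => hg j)

/-- Mirror-descent regret with periodic restarts. -/
theorem stmt_14 {S A : Type*} [Fintype S] [Fintype A] [Nonempty S] [Nonempty A]
    (H K L τ : ℕ) (hK : K = L * τ) (η : ℝ) (hη : 0 < η)
    (Qhat : ℕ → ℕ → S → A → ℝ)
    (hQhat : ∀ k ∈ Finset.Icc 1 K, ∀ h ∈ Finset.Icc 1 H, ∀ s a,
      0 ≤ Qhat k h s a ∧ Qhat k h s a ≤ 1)
    (π : ℕ → ℕ → S → A → ℝ)
    -- restart: at rounds `k ≡ 1 (mod τ)` the policy is uniform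
    (hrestart : ∀ k ∈ Finset.Icc 1 K, k % τ = 1 % τ → ∀ h ∈ Finset.Icc 1 H, ∀ s a,
      π k h s a = 1 / (Fintype.card A : ℝ))
    -- otherwise: exponential-weights (mirror descent) update
    (hupdate : ∀ k ∈ Finset.Icc 1 K, ¬ k % τ = 1 % τ → ∀ h ∈ Finset.Icc 1 H, ∀ s a,
      π k h s a = π (k - 1) h s a * Real.exp (η * Qhat (k - 1) h s a) /
        ∑ a', π (k - 1) h s a' * Real.exp (η * Qhat (k - 1) h s a'))
    -- arbitrary comparator policies
    (πstar : ℕ → ℕ → S → A → ℝ)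
    (hπstar : ∀ k ∈ Finset.Icc 1 K, ∀ h ∈ Finset.Icc 1 H, ∀ s,
      (∀ a, 0 ≤ πstar k h s a) ∧ ∑ a, πstar k h s a = 1)
    -- arbitrary state distributions, one per block and step
    (ρ : ℕ → ℕ → S → ℝ)
    (hρ : ∀ l ∈ Finset.Icc 1 L, ∀ h ∈ Finset.Icc 1 H,
      (∀ s, 0 ≤ ρ l h s) ∧ ∑ s, ρ l h s = 1) :
    ∑ l ∈ Finset.Icc 1 L, ∑ k ∈ Finset.Icc ((l - 1) * τ + 1) (l * τ), ∑ h ∈ Finset.Icc 1 H,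
        ∑ s, ρ l h s * ∑ a, Qhat k h s a * (πstar k h s a - π k h s a) ≤
      η * K * H / 2 + L * H * Real.log (Fintype.card A) / η +
        τ * ∑ k ∈ Finset.Icc 2 K, ∑ h ∈ Finset.Icc 1 H,
          Finset.univ.sup' Finset.univ_nonempty
            (fun s => (1 / 2) * ∑ a, |πstar k h s a - πstar (k - 1) h s a|) := by
  set M : ℕ → ℕ → ℝ := fun k h => Finset.univ.sup' Finset.univ_nonempty
    (fun s => (1 / 2) * ∑ a, |πstar k h s a - πstar (k - 1) h s a|)
  have hMle : ∀ k h s, (1 / 2) * ∑ a, |πstar k h s a - πstar (k - 1) h s a| ≤ M k h :=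
    fun k h s => Finset.le_sup' (fun s => (1 / 2) * ∑ a, |πstar k h s a - πstar (k - 1) h s a|)
      (Finset.mem_univ s)
  have hM0 : ∀ k h, 0 ≤ M k h := fun k h =>
    le_trans (by positivity) (hMle k h (Classical.arbitrary S))
  have hmem : ∀ i < L, ∀ t < τ, i * τ + 1 + t ∈ Finset.Icc 1 K := by
    intro i hi t ht
    have : (i + 1) * τ ≤ L * τ := Nat.mul_le_mul_right τ hi
    rw [Nat.succ_mul] at this
    rw [Finset.mem_Icc]
    omega
  have hπ : ∀ i < L, ∀ h ∈ Finset.Icc 1 H, ∀ s, ∀ t < τ, ∀ a, π (i * τ + 1 + t) h s a =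
      expWeights η (fun t => Qhat (i * τ + 1 + t) h s) t a := by
    intro i hi h hh s t
    induction t with
    | zero =>
      intro ht a
      rw [hrestart _ (hmem i hi 0 ht) (by simp [Nat.add_mod]) h hh s a, expWeights]
    | succ t ih =>
      intro ht a
      have hmod : ¬ (i * τ + 1 + (t + 1)) % τ = 1 % τ := by
        rw [show i * τ + 1 + (t + 1) = (t + 2) + τ * i by ring, Nat.add_mul_mod_self_left,
          Nat.mod_eq_of_lt (show 1 < τ by omega)]
        rcases Nat.lt_or_ge (t + 2) τ with h2 | h2
        · rw [Nat.mod_eq_of_lt h2]; omega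
        · rw [show t + 2 = τ by omega, Nat.mod_self]; omega
      rw [hupdate _ (hmem i hi _ ht) hmod h hh s a,
        show i * τ + 1 + (t + 1) - 1 = i * τ + 1 + t by omega, expWeights]
      simp only [ih (by omega)]
  have hblock : ∀ i < L, ∀ h ∈ Finset.Icc 1 H,
      ∑ t ∈ Finset.range τ, ∑ s, ρ (i + 1) h s * ∑ a, Qhat (i * τ + 1 + t) h s a *
        (πstar (i * τ + 1 + t) h s a - π (i * τ + 1 + t) h s a) ≤
      η * τ / 2 + Real.log (Fintype.card A) / η +
        τ * ∑ j ∈ Finset.range (τ - 1), M (i * τ + j + 2) h := by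
    intro i hi h hh
    obtain ⟨hρ0, hρ1⟩ := hρ (i + 1) (Finset.mem_Icc.2 ⟨by omega, hi⟩) h hh
    rw [Finset.sum_comm]
    simp only [← Finset.mul_sum]
    rw [← one_mul (η * τ / 2 + _ + _), ← hρ1, Finset.sum_mul]
    refine Finset.sum_le_sum fun s _ => mul_le_mul_of_nonneg_left ?_ (hρ0 s)
    have hreg := expWeights_tracking_regret hη (q := fun t => Qhat (i * τ + 1 + t) h s)
      (p := fun t => πstar (i * τ + 1 + t) h s) (M := fun j => M (i * τ + j + 2) h) τ
      (fun t ht => hπstar _ (hmem i hi t ht) h hh s)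
      (fun t ht => hQhat _ (hmem i hi t ht) h hh s) (fun j => hM0 _ h) (fun j _ => by
        have := hMle (i * τ + j + 2) h s
        rw [show i * τ + j + 2 - 1 = i * τ + 1 + j by omega] at this
        rwa [show i * τ + 1 + (j + 1) = i * τ + j + 2 by omega])
    refine le_trans (le_of_eq ?_) hreg
    refine Finset.sum_congr rfl fun t ht => Finset.sum_congr rfl fun a _ => ?_
    rw [hπ i hi h hh s t (Finset.mem_range.1 ht) a]
  have hdrift : ∑ i ∈ Finset.range L, ∑ h ∈ Finset.Icc 1 H, ∑ j ∈ Finset.range (τ - 1),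
      M (i * τ + j + 2) h ≤ ∑ k ∈ Finset.Icc 2 K, ∑ h ∈ Finset.Icc 1 H, M k h := by
    have hK2 : ∑ k ∈ Finset.Icc 2 K, ∑ h ∈ Finset.Icc 1 H, M k h =
        ∑ j ∈ Finset.range (L * τ - 1), ∑ h ∈ Finset.Icc 1 H, M (j + 2) h := by
      rw [← Finset.Ico_add_one_right_eq_Icc, Finset.sum_Ico_eq_sum_range,
        show K + 1 - 2 = L * τ - 1 by omega]
      simp only [add_comm 2]
    rw [hK2]
    refine le_trans (le_of_eq ?_) (sum_blocks_le (g := fun j => ∑ h ∈ Finset.Icc 1 H, M (j + 2) h)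
      (fun j => Finset.sum_nonneg fun h _ => hM0 _ h) L τ)
    exact Finset.sum_congr rfl fun i _ => Finset.sum_comm
  have hlhs : ∑ l ∈ Finset.Icc 1 L, ∑ k ∈ Finset.Icc ((l - 1) * τ + 1) (l * τ),
      ∑ h ∈ Finset.Icc 1 H, ∑ s, ρ l h s * ∑ a, Qhat k h s a * (πstar k h s a - π k h s a) =
      ∑ i ∈ Finset.range L, ∑ h ∈ Finset.Icc 1 H, ∑ t ∈ Finset.range τ, ∑ s, ρ (i + 1) h s *
        ∑ a, Qhat (i * τ + 1 + t) h s a *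
          (πstar (i * τ + 1 + t) h s a - π (i * τ + 1 + t) h s a) := by
    have houter := sum_Icc_add_eq_sum_range 0 L fun l =>
      ∑ k ∈ Finset.Icc ((l - 1) * τ + 1) (l * τ), ∑ h ∈ Finset.Icc 1 H,
        ∑ s, ρ l h s * ∑ a, Qhat k h s a * (πstar k h s a - π k h s a)
    simp only [zero_add] at houter
    rw [houter]
    refine Finset.sum_congr rfl fun i _ => ?_
    rw [show 1 + i = i + 1 by omega, Nat.add_sub_cancel, Nat.succ_mul, sum_Icc_add_eq_sum_range,
      Finset.sum_comm]
  rw [hlhs]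
  calc _ ≤ ∑ i ∈ Finset.range L, ∑ h ∈ Finset.Icc 1 H,
        (η * τ / 2 + Real.log (Fintype.card A) / η +
          τ * ∑ j ∈ Finset.range (τ - 1), M (i * τ + j + 2) h) :=
        Finset.sum_le_sum fun i hi => Finset.sum_le_sum fun h hh =>
          hblock i (Finset.mem_range.1 hi) h hh
    _ = η * K * H / 2 + L * H * Real.log (Fintype.card A) / η +
        τ * ∑ i ∈ Finset.range L, ∑ h ∈ Finset.Icc 1 H, ∑ j ∈ Finset.range (τ - 1),
          M (i * τ + j + 2) h := by
        simp only [Finset.sum_add_distrib, ← Finset.mul_sum, Finset.sum_const, Finset.card_range,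
          Nat.card_Icc, nsmul_eq_mul, Nat.add_sub_cancel, hK]
        push_cast
        ring
    _ ≤ _ := by gcongr
end

section
/- (Distribution-shift term bound.) Let S and A be finite sets, H, K, L, τ ∈ ℕ with K = L·τ, and fix an initial state s₁ ∈ S. For each k ∈ {1,…,K} let P^{⋆,k} = {P^{⋆,k}_h} be a transition kernel sequence S × A → Δ(S), let π^{⋆,k} and π^k be policies, and let Q̂^k_h : S × A → [0,1]. For each k and h let d^k_h ∈ Δ(S) be the step-h state distribution under (P^{⋆,k}, π^{⋆,k}) started from s₁, and let a(k) = (⌈k/τ⌉ − 1)·τ + 1 be the first round of the block containing k. Then Σ_{k=1}^{K} Σ_{h=1}^{H} ( E_{s∼d^k_h} − E_{s∼d^{a(k)}_h} ) [ Σ_{a∈A} Q̂^k_h(s,a)·( π^{⋆,k}_h(a|s) − π^k_h(a|s) ) ] ≤ 2·H·τ·( Δ^P + Δ^π ), where Δ^P = Σ_{k=2}^{K} Σ_{h=1}^{H} max_{(s,a)} ‖P^{⋆,k}_h(·|s,a) − P^{⋆,k−1}_h(·|s,a)‖_TV and Δ^π = Σ_{k=2}^{K} Σ_{h=1}^{H}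 max_{s} ‖π^{⋆,k}_h(·|s) − π^{⋆,k−1}_h(·|s)‖_TV. -/
/-- One-step perturbation bound, in `ℓ¹` norm, for pushing a state distribution through a policy
and a transition kernel. -/
theorem sum_abs_sub_step_le {S A : Type*} [Fintype S] [Fintype A]
    {d d' : S → ℝ} {p p' : S → A → ℝ} {P P' : S → A → S → ℝ} {εp εP : ℝ}
    (hd' : ∀ s, 0 ≤ d' s) (hd'1 : ∑ s, d' s = 1)
    (hp : ∀ s, (∀ a, 0 ≤ p s a) ∧ ∑ a, p s a = 1)
    (hp' : ∀ s, (∀ a, 0 ≤ p' s a) ∧ ∑ a, p' s a = 1)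
    (hP : ∀ s a, (∀ s', 0 ≤ P s a s') ∧ ∑ s', P s a s' = 1)
    (hεp : ∀ s, ∑ a, |p s a - p' s a| ≤ εp)
    (hεP : ∀ s a, ∑ s', |P s a s' - P' s a s'| ≤ εP) :
    ∑ s', |(∑ s, ∑ a, d s * p s a * P s a s') - ∑ s, ∑ a, d' s * p' s a * P' s a s'| ≤
      (∑ s, |d s - d' s|) + (εP + εp) := by
  have pointwise : ∀ s', |(∑ s, ∑ a, d s * p s a * P s a s')
        - ∑ s, ∑ a, d' s * p' s a * P' s a s'| ≤
      ∑ s, ∑ a, (|d s - d' s| * p s a * P s a s' + d' s * |p s a - p' s a| * P s a s'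
        + d' s * p' s a * |P s a s' - P' s a s'|) := by
    intro s'
    rw [← Finset.sum_sub_distrib]
    refine (Finset.abs_sum_le_sum_abs _ _).trans (Finset.sum_le_sum fun s _ => ?_)
    rw [← Finset.sum_sub_distrib]
    refine (Finset.abs_sum_le_sum_abs _ _).trans (Finset.sum_le_sum fun b _ => ?_)
    have split : d s * p s b * P s b s' - d' s * p' s b * P' s b s' =
        (d s - d' s) * p s b * P s b s' + d' s * (p s b - p' s b) * P s b s'
          + d' s * p' s b * (P s b s' - P' s b s') := by ring
    rw [split]
    refine (abs_add_three _ _ _).trans (le_of_eq ?_)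
    simp only [abs_mul, abs_of_nonneg (hd' s), abs_of_nonneg ((hp s).1 b),
      abs_of_nonneg ((hp' s).1 b), abs_of_nonneg ((hP s b).1 s')]
  refine (Finset.sum_le_sum fun s' _ => pointwise s').trans ?_
  rw [Finset.sum_comm]
  have per_state : ∀ s, ∑ s', ∑ a, (|d s - d' s| * p s a * P s a s'
        + d' s * |p s a - p' s a| * P s a s' + d' s * p' s a * |P s a s' - P' s a s'|) ≤
      |d s - d' s| + d' s * (εP + εp) := by
    intro s
    rw [Finset.sum_comm]
    simp only [Finset.sum_add_distrib, ← Finset.mul_sum, (hP s _).2, mul_one, (hp s).2]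
    have kernel_part : ∑ b, d' s * p' s b * ∑ s', |P s b s' - P' s b s'| ≤ d' s * εP := by
      calc _ ≤ ∑ b, d' s * p' s b * εP := Finset.sum_le_sum fun b _ =>
            mul_le_mul_of_nonneg_left (hεP s b) (mul_nonneg (hd' s) ((hp' s).1 b))
        _ = d' s * εP := by rw [← Finset.sum_mul, ← Finset.mul_sum, (hp' s).2, mul_one]
    have policy_part := mul_le_mul_of_nonneg_left (hεp s) (hd' s)
    linarith
  refine (Finset.sum_le_sum fun s _ => per_state s).trans (le_of_eq ?_)
  rw [Finset.sum_add_distrib, ← Finset.sum_mul, hd'1, one_mul]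

/-- Telescoping triangle inequality for the `ℓ¹` distance along a sequence. -/
theorem sum_abs_sub_le_sum_Ioc {S : Type*} [Fintype S] {f : ℕ → S → ℝ} {ε : ℕ → ℝ} {m n : ℕ}
    (hmn : m ≤ n) (hf : ∀ j ∈ Finset.Ioc m n, ∑ s, |f j s - f (j - 1) s| ≤ ε j) :
    ∑ s, |f n s - f m s| ≤ ∑ j ∈ Finset.Ioc m n, ε j := by
  induction n, hmn using Nat.le_induction with
  | base => simp
  | succ n hmn ih =>
    rw [Finset.sum_Ioc_succ_top (by omega)]
    have last := hf (n + 1) (Finset.mem_Ioc.2 ⟨by omega, le_rfl⟩)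
    have init := ih fun j hj => hf j (Finset.Ioc_subset_Ioc_right n.le_succ hj)
    have triangle : ∑ s, |f (n + 1) s - f m s| ≤
        ∑ s, |f n s - f m s| + ∑ s, |f (n + 1) s - f (n + 1 - 1) s| := by
      rw [← Finset.sum_add_distrib]
      refine Finset.sum_le_sum fun s _ => ?_
      exact (abs_sub_le _ (f n s) _).trans (add_comm _ _).le
    linarith

/-- If every window `(a k, k]` with `1 ≤ a k` has fewer than `τ` elements, summing a nonnegative
sequence over all windows counts each term at most `τ` times. -/
theorem sum_sum_Ioc_le {ε : ℕ → ℝ} {K τ : ℕ} {a : ℕ → ℕ} (hε : ∀ j ∈ Finset.Icc 2 K, 0 ≤ ε j)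
    (ha : ∀ k ∈ Finset.Icc 1 K, 1 ≤ a k ∧ k < a k + τ) :
    ∑ k ∈ Finset.Icc 1 K, ∑ j ∈ Finset.Ioc (a k) k, ε j ≤ τ * ∑ j ∈ Finset.Icc 2 K, ε j := by
  have swap : ∑ k ∈ Finset.Icc 1 K, ∑ j ∈ Finset.Ioc (a k) k, ε j =
      ∑ j ∈ Finset.Icc 2 K, ∑ k ∈ Finset.Icc 1 K with j ∈ Finset.Ioc (a k) k, ε j := by
    refine Finset.sum_comm' fun k j => ?_
    simp only [Finset.mem_filter, Finset.mem_Icc, Finset.mem_Ioc]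
    constructor
    · rintro ⟨hk, hj⟩
      have := ha k (Finset.mem_Icc.2 hk)
      omega
    · rintro ⟨hk, -⟩
      exact hk
  rw [swap, Finset.mul_sum]
  refine Finset.sum_le_sum fun j hj => ?_
  rw [Finset.sum_const, nsmul_eq_mul]
  refine mul_le_mul_of_nonneg_right ?_ (hε j hj)
  have subset : (Finset.Icc 1 K).filter (fun k => j ∈ Finset.Ioc (a k) k) ⊆
      Finset.Ico j (j + τ) := by
    intro k hk
    simp only [Finset.mem_filter, Finset.mem_Ioc] at hk
    have := ha k hk.1
    rw [Finset.mem_Ico]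
    omega
  have card_le := Finset.card_le_card subset
  rw [Nat.card_Ico, Nat.add_sub_cancel_left] at card_le
  exact_mod_cast card_le

/-- The difference of two averages of a `[0, 1]`-valued function has absolute value at most `1`. -/
theorem abs_sum_mul_sub_le_one {A : Type*} [Fintype A] {q p p' : A → ℝ}
    (hq : ∀ a, 0 ≤ q a ∧ q a ≤ 1) (hp : (∀ a, 0 ≤ p a) ∧ ∑ a, p a = 1)
    (hp' : (∀ a, 0 ≤ p' a) ∧ ∑ a, p' a = 1) :
    |∑ a, q a * (p a - p' a)| ≤ 1 := by
  have average : ∀ r : A → ℝ, (∀ a, 0 ≤ r a) ∧ ∑ a, r a = 1 →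
      0 ≤ ∑ a, q a * r a ∧ ∑ a, q a * r a ≤ 1 := fun r hr =>
    ⟨Finset.sum_nonneg fun b _ => mul_nonneg (hq b).1 (hr.1 b),
      hr.2 ▸ Finset.sum_le_sum fun b _ => mul_le_of_le_one_left (hr.1 b) (hq b).2⟩
  simp only [mul_sub, Finset.sum_sub_distrib]
  have := average p hp
  have := average p' hp'
  rw [abs_le]
  constructor <;> linarith

/-- Distribution-shift term bound. -/
theorem stmt_15 {S A : Type*} [Fintype S] [Fintype A] [Nonempty S] [Nonempty A] [DecidableEq S]
    (H K L τ : ℕ) (hτ : 1 ≤ τ) (hK : K = L * τ) (s₁ : S)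
    (Pstar : ℕ → ℕ → S → A → S → ℝ)
    (hPstar : ∀ k ∈ Finset.Icc 1 K, ∀ h ∈ Finset.Icc 1 H, ∀ s a,
      (∀ s', 0 ≤ Pstar k h s a s') ∧ ∑ s', Pstar k h s a s' = 1)
    (πstar π : ℕ → ℕ → S → A → ℝ)
    (hπstar : ∀ k ∈ Finset.Icc 1 K, ∀ h ∈ Finset.Icc 1 H, ∀ s,
      (∀ a, 0 ≤ πstar k h s a) ∧ ∑ a, πstar k h s a = 1)
    (hπ : ∀ k ∈ Finset.Icc 1 K, ∀ h ∈ Finset.Icc 1 H, ∀ s,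
      (∀ a, 0 ≤ π k h s a) ∧ ∑ a, π k h s a = 1)
    (Qhat : ℕ → ℕ → S → A → ℝ)
    (hQhat : ∀ k ∈ Finset.Icc 1 K, ∀ h ∈ Finset.Icc 1 H, ∀ s a,
      0 ≤ Qhat k h s a ∧ Qhat k h s a ≤ 1)
    -- `dd k h` : step-`h` state distribution under `(Pstar k, πstar k)` started from `s₁`
    (dd : ℕ → ℕ → S → ℝ)
    (hd1 : ∀ k ∈ Finset.Icc 1 K, ∀ s, dd k 1 s = if s = s₁ then 1 else 0)
    (hdstep : ∀ k ∈ Finset.Icc 1 K, ∀ h ∈ Finset.Icc 1 H, ∀ s',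
      dd k (h + 1) s' = ∑ s, ∑ a, dd k h s * πstar k h s a * Pstar k h s a s')
    -- `a k` : first round of the block (of length τ) containing round k
    (a : ℕ → ℕ)
    (ha : ∀ k, a k = ((k + τ - 1) / τ - 1) * τ + 1) :
    ∑ k ∈ Finset.Icc 1 K, ∑ h ∈ Finset.Icc 1 H,
        ((∑ s, dd k h s * ∑ b, Qhat k h s b * (πstar k h s b - π k h s b)) -
         (∑ s, dd (a k) h s * ∑ b, Qhat k h s b * (πstar k h s b - π k h s b))) ≤
      2 * H * τ *
        ((∑ k ∈ Finset.Icc 2 K, ∑ h ∈ Finset.Icc 1 H,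
            Finset.univ.sup' Finset.univ_nonempty
              (fun sa : S × A =>
                (1 / 2) * ∑ s', |Pstar k h sa.1 sa.2 s' - Pstar (k - 1) h sa.1 sa.2 s'|)) +
         (∑ k ∈ Finset.Icc 2 K, ∑ h ∈ Finset.Icc 1 H,
            Finset.univ.sup' Finset.univ_nonempty
              (fun s : S => (1 / 2) * ∑ b, |πstar k h s b - πstar (k - 1) h s b|))) := by
  set εP : ℕ → ℕ → ℝ := fun k h => Finset.univ.sup' Finset.univ_nonempty
    (fun sa : S × A =>
      (1 / 2) * ∑ s', |Pstar k h sa.1 sa.2 s' - Pstar (k - 1) h sa.1 sa.2 s'|) with hεP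
  set επ : ℕ → ℕ → ℝ := fun k h => Finset.univ.sup' Finset.univ_nonempty
    (fun s : S => (1 / 2) * ∑ b, |πstar k h s b - πstar (k - 1) h s b|) with hεπ
  have le_εP : ∀ k h s b, ∑ s', |Pstar k h s b s' - Pstar (k - 1) h s b s'| ≤ 2 * εP k h := by
    intro k h s b
    have := Finset.le_sup' (fun sa : S × A =>
      (1 / 2) * ∑ s', |Pstar k h sa.1 sa.2 s' - Pstar (k - 1) h sa.1 sa.2 s'|)
      (Finset.mem_univ (s, b))
    simp only [hεP]
    linarith
  have le_επ : ∀ k h s, ∑ b, |πstar k h s b - πstar (k - 1) h s b| ≤ 2 * επ k h := by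
    intro k h s
    have := Finset.le_sup' (fun s : S =>
      (1 / 2) * ∑ b, |πstar k h s b - πstar (k - 1) h s b|) (Finset.mem_univ s)
    simp only [hεπ]
    linarith
  have ε_nonneg : ∀ k h, 0 ≤ εP k h + επ k h := by
    intro k h
    have hP := (Finset.sum_nonneg fun s' _ => abs_nonneg _).trans
      (le_εP k h s₁ (Classical.arbitrary A))
    have hp := (Finset.sum_nonneg fun b _ => abs_nonneg _).trans (le_επ k h s₁)
    linarith
  have dd_prob : ∀ k ∈ Finset.Icc 1 K, ∀ h, 1 ≤ h → h ≤ H →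
      (∀ s, 0 ≤ dd k h s) ∧ ∑ s, dd k h s = 1 := by
    intro k hk h h1
    induction h, h1 using Nat.le_induction with
    | base =>
      refine fun _ => ⟨fun s => ?_, ?_⟩
      · rw [hd1 k hk]
        split_ifs <;> norm_num
      · simp [hd1 k hk]
    | succ h h1 ih =>
      intro hH
      have hh : h ∈ Finset.Icc 1 H := Finset.mem_Icc.2 ⟨h1, by omega⟩
      obtain ⟨nonneg, total⟩ := ih (by omega)
      refine ⟨fun s' => ?_, ?_⟩
      · rw [hdstep k hk h hh]
        exact Finset.sum_nonneg fun s _ => Finset.sum_nonneg fun b _ =>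
          mul_nonneg (mul_nonneg (nonneg s) ((hπstar k hk h hh s).1 b))
            ((hPstar k hk h hh s b).1 s')
      · simp only [hdstep k hk h hh]
        rw [Finset.sum_comm, ← total]
        refine Finset.sum_congr rfl fun s _ => ?_
        rw [Finset.sum_comm]
        simp only [← Finset.mul_sum, (hPstar k hk h hh s _).2, mul_one, (hπstar k hk h hh s).2]
  have dd_consecutive : ∀ k ∈ Finset.Icc 2 K, ∀ h, 1 ≤ h → h ≤ H →
      ∑ s, |dd k h s - dd (k - 1) h s| ≤ ∑ i ∈ Finset.Ico 1 h, 2 * (εP k i + επ k i) := by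
    intro k hk h h1
    have hk2 := Finset.mem_Icc.1 hk
    have hk' : k ∈ Finset.Icc 1 K := Finset.mem_Icc.2 ⟨by omega, hk2.2⟩
    have hk1 : k - 1 ∈ Finset.Icc 1 K := Finset.mem_Icc.2 ⟨by omega, by omega⟩
    induction h, h1 using Nat.le_induction with
    | base => simp [hd1 k hk', hd1 (k - 1) hk1]
    | succ h h1 ih =>
      intro hH
      have hh : h ∈ Finset.Icc 1 H := Finset.mem_Icc.2 ⟨h1, by omega⟩
      obtain ⟨nonneg, total⟩ := dd_prob (k - 1) hk1 h h1 (by omega)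
      have step := sum_abs_sub_step_le (d := dd k h) nonneg total (hπstar k hk' h hh)
        (hπstar (k - 1) hk1 h hh) (hPstar k hk' h hh) (le_επ k h) (le_εP k h)
      simp only [hdstep k hk' h hh, hdstep (k - 1) hk1 h hh]
      rw [Finset.sum_Ico_succ_top h1]
      linarith [ih (by omega)]
  have dd_shift : ∀ k ∈ Finset.Icc 2 K, ∀ h ∈ Finset.Icc 1 H,
      ∑ s, |dd k h s - dd (k - 1) h s| ≤ ∑ i ∈ Finset.Icc 1 H, 2 * (εP k i + επ k i) := by
    intro k hk h hh
    have hh' := Finset.mem_Icc.1 hh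
    refine (dd_consecutive k hk h hh'.1 hh'.2).trans
      (Finset.sum_le_sum_of_subset_of_nonneg ?_ fun i _ _ => by linarith [ε_nonneg k i])
    intro i hi
    rw [Finset.mem_Ico] at hi
    exact Finset.mem_Icc.2 ⟨hi.1, by omega⟩
  have a_block : ∀ k ∈ Finset.Icc 1 K, 1 ≤ a k ∧ a k ≤ k ∧ k < a k + τ := by
    intro k hk
    have hk' := Finset.mem_Icc.1 hk
    have quotient : (k + τ - 1) / τ - 1 = (k - 1) / τ := by
      rw [show k + τ - 1 = k - 1 + τ by omega, Nat.add_div_right _ hτ, Nat.add_sub_cancel]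
    have div_mod := Nat.div_add_mod' (k - 1) τ
    have mod_lt := Nat.mod_lt (k - 1) hτ
    rw [ha k, quotient]
    omega
  have term_le : ∀ k ∈ Finset.Icc 1 K, ∀ h ∈ Finset.Icc 1 H,
      (∑ s, dd k h s * ∑ b, Qhat k h s b * (πstar k h s b - π k h s b)) -
        (∑ s, dd (a k) h s * ∑ b, Qhat k h s b * (πstar k h s b - π k h s b)) ≤
      ∑ j ∈ Finset.Ioc (a k) k, ∑ i ∈ Finset.Icc 1 H, 2 * (εP j i + επ j i) := by
    intro k hk h hh
    obtain ⟨ha1, hak, -⟩ := a_block k hk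
    refine le_trans ?_ (sum_abs_sub_le_sum_Ioc (f := fun j => dd j h) hak fun j hj =>
      dd_shift j ?_ h hh)
    · rw [← Finset.sum_sub_distrib]
      refine Finset.sum_le_sum fun s _ => ?_
      rw [← sub_mul]
      refine (le_abs_self _).trans ?_
      rw [abs_mul]
      exact mul_le_of_le_one_right (abs_nonneg _)
        (abs_sum_mul_sub_le_one (hQhat k hk h hh s) (hπstar k hk h hh s) (hπ k hk h hh s))
    · have := Finset.mem_Icc.1 hk
      rw [Finset.mem_Ioc] at hj
      exact Finset.mem_Icc.2 ⟨by omega, by omega⟩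
  calc _ ≤ ∑ k ∈ Finset.Icc 1 K, ∑ h ∈ Finset.Icc 1 H,
          ∑ j ∈ Finset.Ioc (a k) k, ∑ i ∈ Finset.Icc 1 H, 2 * (εP j i + επ j i) :=
        Finset.sum_le_sum fun k hk => Finset.sum_le_sum fun h hh => term_le k hk h hh
    _ = H * ∑ k ∈ Finset.Icc 1 K, ∑ j ∈ Finset.Ioc (a k) k,
          ∑ i ∈ Finset.Icc 1 H, 2 * (εP j i + επ j i) := by
        simp [Finset.mul_sum]
    _ ≤ H * (τ * ∑ j ∈ Finset.Icc 2 K, ∑ i ∈ Finset.Icc 1 H, 2 * (εP j i + επ j i)) :=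
        mul_le_mul_of_nonneg_left
          (sum_sum_Ioc_le
            (fun j _ => Finset.sum_nonneg fun i _ => by linarith [ε_nonneg j i])
            (fun k hk => ⟨(a_block k hk).1, (a_block k hk).2.2⟩))
          (Nat.cast_nonneg H)
    _ = _ := by
        simp only [← Finset.mul_sum, Finset.sum_add_distrib]
        ring
end
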